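/- In the minimum-counterexample setup, for every acyclic edge coloring c of G−xy using Δ+1 colors and every color γ ∈ F'_x(c), say γ = c(x,w) where w is a degree-2 neighbor of x with w ≠ y, there exists a (μ,γ,xy)-critical path with respect to the partial coloring c_γ obtained from c by uncoloring the edge xw, where μ = c(y,y'). -/

import Mathlib

open SimpleGraph

namespace AEC

variable {V : Type*}

/-- The set of colors appearing (under partial coloring `c`) on colored edges incident
with the vertex `u` (i.e. `F_u`). -/
def colorsAt (G : SimpleGraph V) (c : Sym2 V → Option ℕ) (u : V) : Set ℕ :=
  {γ | ∃ z, G.Adj u z ∧ c s(u, z) = some γ}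

/-- `S_ab`: the set of colors appearing on the colored edges incident with `b`
other than the edge `ab`. -/
def Sset (G : SimpleGraph V) (c : Sym2 V → Option ℕ) (a b : V) : Set ℕ :=
  {γ | ∃ z, G.Adj b z ∧ z ≠ a ∧ c s(b, z) = some γ}

/-- A partial edge coloring (colors are `ℕ`, `none` = uncolored): it may only color
edges of `G`, and colored edges sharing an endpoint receive distinct colors. -/
def ProperPartialColoring (G : SimpleGraph V) (c : Sym2 V → Option ℕ) : Prop :=
  (∀ e, (c e).isSome → e ∈ G.edgeSet) ∧
  ∀ ⦃u v w : V⦄, G.Adj u v → G.Adj u w → v ≠ w → (c s(u, v)).isSome →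
    c s(u, v) ≠ c s(u, w)

/-- A valid (acyclic) partial coloring: proper, and no cycle of `G` is bichromatic,
i.e. no cycle has all of its edges colored using only two colors. -/
def AcyclicPartialColoring (G : SimpleGraph V) (c : Sym2 V → Option ℕ) : Prop :=
  ProperPartialColoring G c ∧
  ∀ (α β : ℕ) (v : V) (W : G.Walk v v), W.IsCycle →
    ¬ ∀ e ∈ W.edges, c e = some α ∨ c e = some β

/-- An acyclic edge coloring of `G` using (at most) `k` colors: a valid partial coloring
that colors every edge of `G` with a color `< k`. -/
def IsAcyclicEdgeColoring (G : SimpleGraph V) (k : ℕ) (c : Sym2 V → Option ℕ) : Prop :=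
  AcyclicPartialColoring G c ∧ ∀ e ∈ G.edgeSet, ∃ a, a < k ∧ c e = some a

/-- `G` is 2-degenerate: every nonempty (induced) subgraph has a vertex of degree at most 2. -/
def TwoDegenerate [DecidableEq V] (G : SimpleGraph V) [DecidableRel G.Adj] : Prop :=
  ∀ s : Finset V, s.Nonempty → ∃ v ∈ s, (s.filter fun u => G.Adj v u).card ≤ 2

/-- A maximal `(α,β)`-bichromatic path from `a` to `b`: a path all of whose edges are
colored `α` or `β`, which cannot be extended at either end. -/
def IsMaximalBichromaticPath (G : SimpleGraph V) (c : Sym2 V → Option ℕ)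
    (α β : ℕ) {a b : V} (W : G.Walk a b) : Prop :=
  W.IsPath ∧ (∀ e ∈ W.edges, c e = some α ∨ c e = some β) ∧
  (∀ w, G.Adj a w → (c s(a, w) = some α ∨ c s(a, w) = some β) → w ∈ W.support) ∧
  (∀ w, G.Adj b w → (c s(b, w) = some α ∨ c s(b, w) = some β) → w ∈ W.support)

/-- An `(α,β,a,b)`-maximal bichromatic path: a maximal `(α,β)`-bichromatic path from
`a` to `b` whose edge incident on `a` is colored `α`. -/
def IsMaxBichromaticPathFrom (G : SimpleGraph V) (c : Sym2 V → Option ℕ)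
    (α β : ℕ) {a b : V} (W : G.Walk a b) : Prop :=
  IsMaximalBichromaticPath G c α β W ∧ ∃ e, W.edges.head? = some e ∧ c e = some α

/-- An `(α,β,ab)`-critical path: a maximal `(α,β)`-bichromatic path from `a` to `b` whose
edges incident on `a` and on `b` are both colored `α`. -/
def IsCriticalPath (G : SimpleGraph V) (c : Sym2 V → Option ℕ)
    (α β : ℕ) {a b : V} (W : G.Walk a b) : Prop :=
  IsMaxBichromaticPathFrom G c α β W ∧ ∃ e, W.edges.getLast? = some e ∧ c e = some α

/-- `F''_x(c)`: colors of edges from `x` to its neighbors (other than `y`) of degree ≥ 3. -/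
def Fpp [Fintype V] (G : SimpleGraph V) [DecidableRel G.Adj]
    (c : Sym2 V → Option ℕ) (x y : V) : Set ℕ :=
  {γ | ∃ z, G.Adj x z ∧ z ≠ y ∧ 3 ≤ G.degree z ∧ c s(x, z) = some γ}

/-- `F'_x(c)`: colors of edges from `x` to its neighbors (other than `y`) of degree 2. -/
def Fp [Fintype V] (G : SimpleGraph V) [DecidableRel G.Adj]
    (c : Sym2 V → Option ℕ) (x y : V) : Set ℕ :=
  {γ | ∃ z, G.Adj x z ∧ z ≠ y ∧ G.degree z = 2 ∧ c s(x, z) = some γ}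

/-- `F_x(c) = F'_x(c) ∪ F''_x(c)`. -/
def Fx [Fintype V] (G : SimpleGraph V) [DecidableRel G.Adj]
    (c : Sym2 V → Option ℕ) (x y : V) : Set ℕ :=
  Fp G c x y ∪ Fpp G c x y

/-- The graph whose edges are the pairs colored `α` or `β` by `c`. -/
def bichrom (c : Sym2 V → Option ℕ) (α β : ℕ) : SimpleGraph V :=
  SimpleGraph.fromEdgeSet {e | c e = some α ∨ c e = some β}

theorem bichrom_adj {c : Sym2 V → Option ℕ} {α β : ℕ} {u v : V} :
    (bichrom c α β).Adj u v ↔ (c s(u, v) = some α ∨ c s(u, v) = some β) ∧ u ≠ v := by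
  simp [bichrom]

theorem mem_edgeSet_bichrom {c : Sym2 V → Option ℕ} {α β : ℕ} {e : Sym2 V}
    (h : e ∈ (bichrom c α β).edgeSet) : c e = some α ∨ c e = some β := by
  simp only [bichrom, edgeSet_fromEdgeSet] at h
  exact h.1

theorem isAcyclicEdgeColoring_iff {G : SimpleGraph V} {k : ℕ}
    {c : Sym2 V → Option ℕ} :
    IsAcyclicEdgeColoring G k c ↔
      (∀ e, (∃ a, c e = some a) ↔ e ∈ G.edgeSet) ∧ (∀ e a, c e = some a → a < k) ∧
      (∀ u v w a, c s(u, v) = some a → c s(u, w) = some a → v = w) ∧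
      ∀ α β, (bichrom c α β).IsAcyclic := by
  constructor
  · rintro ⟨⟨⟨hcol, hprop⟩, hcyc⟩, htot⟩
    have hmem : ∀ e a, c e = some a → e ∈ G.edgeSet := fun e a h => hcol e (by simp [h])
    refine ⟨fun e => ⟨fun ⟨a, h⟩ => hmem e a h, fun h => ?_⟩, fun e a h => ?_,
      fun u v w a hv hw => ?_, fun α β v W hW => ?_⟩
    · obtain ⟨a, -, h⟩ := htot e h
      exact ⟨a, h⟩
    · obtain ⟨b, hb, h'⟩ := htot e (hmem e a h)
      grind
    · by_contra hne
      exact hprop (hmem _ _ hv) (hmem _ _ hw) hne (by simp [hv]) (hv.trans hw.symm)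
    · have hle : bichrom c α β ≤ G := fun u v h =>
        (bichrom_adj.1 h).1.elim (hmem _ _) (hmem _ _)
      refine hcyc α β v (W.mapLe hle) ((Walk.isCycle_mapLe hle).2 hW) fun e he => ?_
      rw [Walk.edges_mapLe_eq_edges] at he
      exact mem_edgeSet_bichrom (W.edges_subset_edgeSet he)
  · rintro ⟨hmem, hlt, hprop, hcyc⟩
    refine ⟨⟨⟨fun e h => (hmem e).1 (Option.isSome_iff_exists.1 h), ?_⟩, ?_⟩, fun e he => ?_⟩
    · intro u v w _ _ hne hs heq
      obtain ⟨a, ha⟩ := Option.isSome_iff_exists.1 hs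
      exact hne (hprop u v w a ha (heq ▸ ha))
    · intro α β v W hW hall
      have hsub : ∀ e ∈ W.edges, e ∈ (bichrom c α β).edgeSet := fun e he => by
        simpa [bichrom] using ⟨hall e he, G.not_isDiag_of_mem_edgeSet (W.edges_subset_edgeSet he)⟩
      exact hcyc α β _ (hW.transfer hsub)
    · obtain ⟨a, ha⟩ := (hmem e).2 he
      exact ⟨a, hlt e a ha, ha⟩

section update

variable [DecidableEq V] {G : SimpleGraph V} {k : ℕ} {c : Sym2 V → Option ℕ}

theorem IsAcyclicEdgeColoring.erase (hc : IsAcyclicEdgeColoring G k c) (e : Sym2 V) :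
    IsAcyclicEdgeColoring (G.deleteEdges {e}) k (Function.update c e none) := by
  rw [isAcyclicEdgeColoring_iff] at hc ⊢
  obtain ⟨hmem, hlt, hprop, hcyc⟩ := hc
  have hold : ∀ f a, Function.update c e none f = some a → c f = some a := by grind
  refine ⟨fun f => ?_, fun f a h => hlt f a (hold f a h),
    fun u v w a hv hw => hprop u v w a (hold _ _ hv) (hold _ _ hw),
    fun α β => (hcyc α β).anti fun u v h => ?_⟩
  · rw [edgeSet_deleteEdges]
    by_cases hf : f = e <;> simp [hf, hmem]
  · rw [bichrom_adj] at h ⊢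
    exact ⟨h.1.imp (hold _ _) (hold _ _), h.2⟩

theorem IsAcyclicEdgeColoring.extend {x y : V} {α : ℕ}
    (hc : IsAcyclicEdgeColoring (G.deleteEdges {s(x, y)}) k c) (hxy : G.Adj x y) (hα : α < k)
    (hx : ∀ z, c s(x, z) ≠ some α) (hy : ∀ z, c s(y, z) ≠ some α)
    (hr : ∀ β, ¬ (bichrom c β α).Reachable x y) :
    IsAcyclicEdgeColoring G k (Function.update c s(x, y) (some α)) := by
  rw [isAcyclicEdgeColoring_iff] at hc ⊢
  obtain ⟨hmem, hlt, hprop, hcyc⟩ := hc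
  have hnew : ∀ f a, Function.update c s(x, y) (some α) f = some a →
      c f = some a ∨ (f = s(x, y) ∧ a = α) := by grind
  refine ⟨fun f => ?_, fun f a h => ?_, fun u v w a hv hw => ?_, fun β δ => ?_⟩
  · by_cases hf : f = s(x, y)
    · simp [hf, hxy]
    · rw [Function.update_of_ne hf, hmem, edgeSet_deleteEdges]
      simp [hf]
  · rcases hnew f a h with h | ⟨-, rfl⟩
    exacts [hlt f a h, hα]
  · rcases hnew _ _ hv with hv | ⟨hv, rfl⟩ <;> rcases hnew _ _ hw with hw | ⟨hw, h⟩
    · exact hprop _ _ _ _ hv hw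
    · grind
    · grind
    · grind
  · have key : ∀ β, (bichrom c β α ⊔ edge x y).IsAcyclic := fun β =>
      (hcyc β α).sup_edge_of_not_reachable (hr β)
    by_cases hβ : β = α
    · refine (key δ).anti fun u v h => ?_
      rw [sup_adj, edge_adj]
      rw [bichrom_adj] at h ⊢
      grind
    · by_cases hδ : δ = α
      · refine (key β).anti fun u v h => ?_
        rw [sup_adj, edge_adj]
        rw [bichrom_adj] at h ⊢
        grind
      · refine (hcyc β δ).anti fun u v h => ?_
        rw [bichrom_adj] at h ⊢
        grind

end update

section paths

theorem walk_end_unique {K : SimpleGraph V}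
    (hK : ∀ v p q r, K.Adj v p → K.Adj v q → K.Adj v r → p = q ∨ p = r ∨ q = r)
    {y w : V} (hy : ∀ p q, K.Adj y p → K.Adj y q → p = q)
    (hw : ∀ p q, K.Adj w p → K.Adj w q → p = q) {a : V} (P : K.Walk a y) (Q : K.Walk a w)
    (hP : P.IsPath) (hQ : Q.IsPath) (b : V) (hb : K.Adj a b)
    (hbP : b ∉ P.support) (hbQ : b ∉ Q.support) : y = w := by
  induction P generalizing b with
  | nil =>
    cases Q with
    | nil => rfl
    | cons h Q' =>
      have := hy _ _ hb h
      simp_all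
  | cons h P' ih =>
    cases Q with
    | nil =>
      have := hw _ _ hb h
      simp_all
    | cons h' Q' =>
      rw [Walk.cons_isPath_iff] at hP hQ
      rcases hK _ _ _ _ hb h h' with h1 | h1 | h1
      · simp_all
      · simp_all
      · subst h1
        exact ih hy Q' hP.1 hQ.1 _ h.symm hP.2 hQ.2

theorem reachable_end_unique {K : SimpleGraph V}
    (hK : ∀ v p q r, K.Adj v p → K.Adj v q → K.Adj v r → p = q ∨ p = r ∨ q = r)
    {x y w : V} (hx : ∀ p q, K.Adj x p → K.Adj x q → p = q)
    (hy : ∀ p q, K.Adj y p → K.Adj y q → p = q) (hw : ∀ p q, K.Adj w p → K.Adj w q → p = q)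
    (hxy : x ≠ y) (hxw : x ≠ w) (h : K.Reachable x y) (h' : K.Reachable x w) : y = w := by
  obtain ⟨P, hP⟩ := h.exists_isPath
  obtain ⟨Q, hQ⟩ := h'.exists_isPath
  cases P with
  | nil => exact absurd rfl hxy
  | cons h P' =>
    cases Q with
    | nil => exact absurd rfl hxw
    | cons h' Q' =>
      obtain rfl := hx _ _ h h'
      rw [Walk.cons_isPath_iff] at hP hQ
      exact walk_end_unique hK hy hw P' Q' hP.1 hQ.1 _ h.symm hP.2 hQ.2

/-- In a properly colored graph, if none of `x`, `y`, `w` sees the color `α`, then at most one of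
`y`, `w` lies in the `(μ,α)`-bichromatic component of `x`. -/
theorem bichrom_end_unique {c : Sym2 V → Option ℕ}
    (hprop : ∀ u v w a, c s(u, v) = some a → c s(u, w) = some a → v = w) {μ α : ℕ} {x y w : V}
    (hx : ∀ z, c s(x, z) ≠ some α) (hy : ∀ z, c s(y, z) ≠ some α) (hw : ∀ z, c s(w, z) ≠ some α)
    (hxy : x ≠ y) (hxw : x ≠ w) (h : (bichrom c μ α).Reachable x y)
    (h' : (bichrom c μ α).Reachable x w) : y = w := by
  have hone : ∀ v, (∀ z, c s(v, z) ≠ some α) → ∀ p q, (bichrom c μ α).Adj v p →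
      (bichrom c μ α).Adj v q → p = q := fun v hv p q hp hq => by
    rw [bichrom_adj] at hp hq
    exact hprop v p q μ (hp.1.resolve_right (hv p)) (hq.1.resolve_right (hv q))
  refine reachable_end_unique (fun v p q r hp hq hr => ?_) (hone x hx) (hone y hy) (hone w hw)
    hxy hxw h h'
  rw [bichrom_adj] at hp hq hr
  grind

theorem exists_adj_of_reachable {K : SimpleGraph V} {x y : V} (h : K.Reachable x y)
    (hne : x ≠ y) : ∃ z, K.Adj x z := by
  obtain ⟨P⟩ := h
  exact ⟨_, P.adj_snd (Walk.not_nil_of_ne hne)⟩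

/-- If `x` has no neighbor other than `z`, a path from `x` to `y ≠ z` leaves `z` by another edge. -/
theorem exists_adj_ne_of_reachable {K : SimpleGraph V} {x y z : V} (h : K.Reachable x y)
    (hxy : x ≠ y) (hzy : z ≠ y) (hz : ∀ u, K.Adj x u → u = z) : ∃ u, K.Adj z u ∧ u ≠ x := by
  obtain ⟨P, hP⟩ := h.exists_isPath
  cases P with
  | nil => exact absurd rfl hxy
  | cons h P' =>
    obtain rfl := hz _ h
    rw [Walk.cons_isPath_iff] at hP
    cases P' with
    | nil => exact absurd rfl hzy
    | cons h' P'' => exact ⟨_, h', by rintro rfl; simp at hP⟩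

theorem exists_isCriticalPath {G : SimpleGraph V} {c : Sym2 V → Option ℕ}
    (hG : ∀ e a, c e = some a → e ∈ G.edgeSet)
    (hprop : ∀ u v w a, c s(u, v) = some a → c s(u, w) = some a → v = w) {μ γ : ℕ} {x y : V}
    (hxy : x ≠ y) (hx : ∀ z, c s(x, z) ≠ some γ) (hy : ∀ z, c s(y, z) ≠ some γ)
    (h : (bichrom c μ γ).Reachable x y) : ∃ W : G.Walk x y, IsCriticalPath G c μ γ W := by
  have hle : bichrom c μ γ ≤ G := fun u v h => (bichrom_adj.1 h).1.elim (hG _ _) (hG _ _)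
  have start : ∀ {u v : V} (W : G.Walk u v), u ≠ v → (∀ z, c s(u, z) ≠ some γ) →
      (∀ e ∈ W.edges, c e = some μ ∨ c e = some γ) →
      (∀ w, G.Adj u w → (c s(u, w) = some μ ∨ c s(u, w) = some γ) → w ∈ W.support) ∧
      ∃ e, W.edges.head? = some e ∧ c e = some μ := by
    intro u v W hne hu hW
    cases W with
    | nil => exact absurd rfl hne
    | @cons _ z _ h W' =>
      have hz : c s(u, z) = some μ := (hW s(u, z) (by simp)).resolve_right (hu z)
      refine ⟨fun w _ hw => ?_, _, rfl, hz⟩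
      obtain rfl := hprop _ _ _ _ hz (hw.resolve_right (hu w))
      simp
  obtain ⟨P, hP⟩ := h.exists_isPath
  have hcol : ∀ e ∈ (P.mapLe hle).edges, c e = some μ ∨ c e = some γ := fun e he => by
    rw [Walk.edges_mapLe_eq_edges] at he
    exact mem_edgeSet_bichrom (P.edges_subset_edgeSet he)
  have h1 := start (P.mapLe hle) hxy hx hcol
  have h2 := start (P.mapLe hle).reverse hxy.symm hy (by simpa using hcol)
  simp only [Walk.support_reverse, List.mem_reverse, Walk.edges_reverse,
    List.head?_reverse] at h2
  exact ⟨P.mapLe hle, ⟨⟨(Walk.isPath_mapLe hle).2 hP, hcol, h1.1, h2.1⟩, h1.2⟩, h2.2⟩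

end paths

section counterexample

variable [Fintype V] [DecidableEq V] {G : SimpleGraph V} [DecidableRel G.Adj]

/-- If `x` has an uncolored edge, at least two colors are missing at `x`. -/
theorem exists_two_missing {c : Sym2 V → Option ℕ} {x y : V} (hxy : G.Adj x y)
    (hc : ∀ z a, c s(x, z) = some a → G.Adj x z ∧ z ≠ y) :
    ∃ α β, α ≠ β ∧ α < G.maxDegree + 1 ∧ β < G.maxDegree + 1 ∧
      (∀ z, c s(x, z) ≠ some α) ∧ ∀ z, c s(x, z) ≠ some β := by
  let S := ((G.neighborFinset x).erase y).image fun z => (c s(x, z)).getD 0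
  have hS : S.card + 1 ≤ G.maxDegree := by
    have h1 : S.card ≤ ((G.neighborFinset x).erase y).card := Finset.card_image_le
    have h2 := Finset.card_erase_add_one ((G.mem_neighborFinset x y).2 hxy)
    have h3 := G.degree_le_maxDegree x
    rw [G.card_neighborFinset_eq_degree] at h2
    omega
  have hcard : 1 < (Finset.range (G.maxDegree + 1) \ S).card := by
    have := Finset.le_card_sdiff S (Finset.range (G.maxDegree + 1))
    rw [Finset.card_range] at this
    omega
  obtain ⟨α, hα, β, hβ, hne⟩ := Finset.one_lt_card.1 hcard
  have miss : ∀ a ∉ S, ∀ z, c s(x, z) ≠ some a := fun a ha z hz =>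
    ha (Finset.mem_image.2 ⟨z, by simp [hc z a hz], by simp [hz]⟩)
  rw [Finset.mem_sdiff, Finset.mem_range] at hα hβ
  exact ⟨α, β, hne, hα.1, hβ.1, miss α hα.2, miss β hβ.2⟩

theorem exists_missing_ne {c : Sym2 V → Option ℕ} {x y : V} {μ : ℕ} (hxy : G.Adj x y)
    (hμ : c s(x, y) = some μ) (hc : ∀ z a, c s(x, z) = some a → G.Adj x z) :
    ∃ θ < G.maxDegree + 1, θ ≠ μ ∧ ∀ z, z ≠ y → c s(x, z) ≠ some θ := by
  obtain ⟨α, β, hne, hα, hβ, hα', hβ'⟩ := exists_two_missing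
    (c := Function.update c s(x, y) none) hxy fun z a h => by
      by_cases hz : s(x, z) = s(x, y)
      · simp [hz] at h
      · rw [Function.update_of_ne hz] at h
        exact ⟨hc z a h, by rintro rfl; exact hz rfl⟩
  have hold : ∀ δ, (∀ z, Function.update c s(x, y) none s(x, z) ≠ some δ) →
      ∀ z, z ≠ y → c s(x, z) ≠ some δ := fun δ h z hz => by
    have := h z
    rwa [Function.update_of_ne (by simpa [hxy.ne] using hz)] at this
  by_cases h : α = μ
  · exact ⟨β, hβ, fun h' => hne (h.trans h'.symm), hold β hβ'⟩
  · exact ⟨α, hα, h, hold α hα'⟩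

/-- If `G` has no acyclic edge coloring with `Δ + 1` colors, `c` colors `G - xy`, and `μ` is the
only color at `y`, then every color missing at `x` forms with `μ` a bichromatic component
containing `x` and `y`, and the color `μ` occurs at `x` on an edge to a vertex of degree at
least 3. -/
theorem reachable_and_exists_degree
    (hmin : ¬ ∃ c : Sym2 V → Option ℕ, IsAcyclicEdgeColoring G (G.maxDegree + 1) c)
    {x y : V} (hxy : G.Adj x y) {c : Sym2 V → Option ℕ}
    (hc : IsAcyclicEdgeColoring (G.deleteEdges {s(x, y)}) (G.maxDegree + 1) c) {μ : ℕ}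
    (hy : ∀ z a, c s(y, z) = some a → a = μ) :
    (∃ z, c s(x, z) = some μ ∧ 3 ≤ G.degree z) ∧
    (∃ α < G.maxDegree + 1, ∀ z, c s(x, z) ≠ some α) ∧
    ∀ α < G.maxDegree + 1, (∀ z, c s(x, z) ≠ some α) → α ≠ μ ∧
      (bichrom c μ α).Reachable x y := by
  obtain ⟨hmem, -, hprop, -⟩ := isAcyclicEdgeColoring_iff.1 hc
  have hadj : ∀ u v a, c s(u, v) = some a → G.Adj u v ∧ s(u, v) ≠ s(x, y) := fun u v a h => by
    simpa using (hmem s(u, v)).1 ⟨a, h⟩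
  obtain ⟨α, β, hne, hα, hβ, hα', hβ'⟩ := exists_two_missing hxy fun z a h =>
    ⟨(hadj x z a h).1, by rintro rfl; exact (hadj x z a h).2 rfl⟩
  have hreach : ∀ α < G.maxDegree + 1, (∀ z, c s(x, z) ≠ some α) → α ≠ μ →
      (bichrom c μ α).Reachable x y := fun α hα hx hαμ => by
    by_contra hr
    refine hmin ⟨_, hc.extend hxy hα hx (fun z hz => hαμ (hy z α hz)) fun β hβr => ?_⟩
    by_cases hβμ : β = μ
    · exact hr (hβμ ▸ hβr)
    · obtain ⟨z, hz⟩ := exists_adj_of_reachable hβr.symm hxy.ne'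
      rcases (bichrom_adj.1 hz).1 with hz | hz
      exacts [hβμ (hy z β hz), hαμ (hy z α hz)]
  have hμx : ∃ z, c s(x, z) = some μ := by
    obtain ⟨δ, hδ, hδ', hδμ⟩ : ∃ δ < G.maxDegree + 1, (∀ z, c s(x, z) ≠ some δ) ∧ δ ≠ μ := by
      by_cases h : α = μ
      · exact ⟨β, hβ, hβ', fun h' => hne (h.trans h'.symm)⟩
      · exact ⟨α, hα, hα', h⟩
    obtain ⟨z, hz⟩ := exists_adj_of_reachable (hreach δ hδ hδ' hδμ) hxy.ne
    exact ⟨z, (bichrom_adj.1 hz).1.resolve_right (hδ' z)⟩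
  obtain ⟨z, hz⟩ := hμx
  have hmiss : ∀ α, (∀ z, c s(x, z) ≠ some α) → α ≠ μ := fun α h hαμ => h z (hαμ ▸ hz)
  have hzy : z ≠ y := by rintro rfl; exact (hadj x z μ hz).2 rfl
  have hnext : ∀ α < G.maxDegree + 1, (∀ z, c s(x, z) ≠ some α) →
      ∃ u, c s(z, u) = some α ∧ u ≠ x := fun α hα hx => by
    obtain ⟨u, hu, hux⟩ := exists_adj_ne_of_reachable (hreach α hα hx (hmiss α hx)) hxy.ne hzy
      fun u hu => hprop x u z μ ((bichrom_adj.1 hu).1.resolve_right (hx u)) hz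
    refine ⟨u, (bichrom_adj.1 hu).1.resolve_left fun h => hux ?_, hux⟩
    exact hprop z u x μ h (by rwa [Sym2.eq_swap])
  refine ⟨⟨z, hz, ?_⟩, ⟨α, hα, hα'⟩, fun α hα hx => ⟨hmiss α hx, hreach α hα hx (hmiss α hx)⟩⟩
  obtain ⟨u, hu, hux⟩ := hnext α hα hα'
  obtain ⟨v, hv, hvx⟩ := hnext β hβ hβ'
  have huv : u ≠ v := by rintro rfl; exact hne (by simpa [hu] using hv)
  have hsub : ({x, u, v} : Finset V) ⊆ G.neighborFinset z := by
    intro t ht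
    simp only [Finset.mem_insert, Finset.mem_singleton] at ht
    rw [mem_neighborFinset]
    rcases ht with rfl | rfl | rfl
    exacts [(hadj _ _ _ hz).1.symm, (hadj _ _ _ hu).1, (hadj _ _ _ hv).1]
  calc 3 = ({x, u, v} : Finset V).card := by
        rw [Finset.card_eq_three.2 ⟨x, u, v, hux.symm, hvx.symm, huv, rfl⟩]
    _ ≤ _ := (Finset.card_le_card hsub).trans_eq (G.card_neighborFinset_eq_degree z)

theorem exists_unique_other_neighbor {x y : V} (hxy : G.Adj y x) (hy : G.degree y = 2) :
    ∃ y', G.Adj y y' ∧ y' ≠ x ∧ ∀ z, G.Adj y z → z = x ∨ z = y' := by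
  rw [← G.card_neighborFinset_eq_degree, Finset.card_eq_two] at hy
  obtain ⟨a, b, hab, h⟩ := hy
  have hN : ∀ z, G.Adj y z ↔ z = a ∨ z = b := fun z => by
    rw [← mem_neighborFinset, h]; simp
  rcases (hN x).1 hxy with rfl | rfl
  · exact ⟨b, (hN b).2 (.inr rfl), hab.symm, fun z hz => (hN z).1 hz⟩
  · exact ⟨a, (hN a).2 (.inl rfl), hab, fun z hz => ((hN z).1 hz).symm⟩

end counterexample

/-- Lemma 7: in the minimum-counterexample setup, for every color
`γ ∈ F'_x(c)`, say `γ = c(x,w)` with `w` a degree-2 neighbor of `x`, `w ≠ y`, there is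
a `(μ,γ,xy)`-critical path with respect to the coloring `c_γ` obtained from `c` by
uncoloring the edge `xw`, where `μ = c(y,y')`. -/
theorem criticalPath_of_mem_Fp
    {V : Type*} [Fintype V] [DecidableEq V] (G : SimpleGraph V) [DecidableRel G.Adj]
    (h2deg : TwoDegenerate G)
    (hmin : ¬ ∃ c : Sym2 V → Option ℕ, IsAcyclicEdgeColoring G (G.maxDegree + 1) c)
    (hdel : ∀ e ∈ G.edgeSet, ∃ c : Sym2 V → Option ℕ,
      IsAcyclicEdgeColoring (G.deleteEdges {e}) (G.maxDegree + 1) c)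
    (x : V)
    (hxdeg2 : ∃ z, G.Adj x z ∧ G.degree z = 2)
    (hxdeg3 : ((G.neighborFinset x).filter fun z => 3 ≤ G.degree z).card ≤ 2)
    (y y' : V) (hxy : G.Adj x y) (hy2 : G.degree y = 2)
    (hyy' : G.Adj y y') (hy'x : y' ≠ x)
    (c : Sym2 V → Option ℕ)
    (hc : IsAcyclicEdgeColoring (G.deleteEdges {s(x, y)}) (G.maxDegree + 1) c)
    (μ γ : ℕ) (hμ : c s(y, y') = some μ)
    (w : V) (hxw : G.Adj x w) (hwy : w ≠ y) (hw2 : G.degree w = 2)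
    (hγ : c s(x, w) = some γ) :
    ∃ W : (G.deleteEdges {s(x, y)}).Walk x y,
      IsCriticalPath (G.deleteEdges {s(x, y)})
        (fun e => if e = s(x, w) then none else c e) μ γ W := by
  obtain ⟨hmem, hlt, hprop, -⟩ := isAcyclicEdgeColoring_iff.1 hc
  have hadj : ∀ u v a, c s(u, v) = some a → G.Adj u v ∧ s(u, v) ≠ s(x, y) := fun u v a h => by
    simpa using (hmem s(u, v)).1 ⟨a, h⟩
  have hyc : ∀ z a, c s(y, z) = some a → z = y' := fun z a h => by
    obtain ⟨v, -, -, hv⟩ := exists_unique_other_neighbor hxy.symm hy2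
    rcases hv z (hadj _ _ _ h).1 with rfl | rfl
    · exact absurd Sym2.eq_swap (hadj _ _ _ h).2
    · exact ((hv y' hyy').resolve_left hy'x).symm
  have hyμ : ∀ z a, c s(y, z) = some a → a = μ := fun z a h => by
    obtain rfl := hyc z a h
    simpa [hμ] using h.symm
  obtain ⟨⟨z₁, hz₁, hdeg₁⟩, ⟨α, hα, hαx⟩, hreach⟩ := reachable_and_exists_degree hmin hxy hc hyμ
  have hμγ : μ ≠ γ := by
    rintro rfl
    obtain rfl := hprop _ _ _ _ hz₁ hγ
    omega
  obtain ⟨hαμ, hcα⟩ := hreach α hα hαx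
  have hαγ : α ≠ γ := by rintro rfl; exact hαx w hγ
  have herase : (fun e => if e = s(x, w) then none else c e) = Function.update c s(x, w) none :=
    funext fun e => by rw [Function.update_apply]
  rw [herase]
  have hc' := hc.erase s(x, w)
  have hcγ := isAcyclicEdgeColoring_iff.1 hc'
  have hxγ : ∀ z, Function.update c s(x, w) none s(x, z) ≠ some γ := fun z hz => by
    have : s(x, z) ≠ s(x, w) := by rintro h; simp [h] at hz
    rw [Function.update_of_ne this] at hz
    obtain rfl := hprop _ _ _ _ hz hγ
    exact this rfl
  have hold : ∀ e a, Function.update c s(x, w) none e = some a → c e = some a := by grind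
  have hyγ : ∀ z, Function.update c s(x, w) none s(y, z) ≠ some γ := fun z hz =>
    hμγ (hyμ z γ (hold _ _ hz)).symm
  refine exists_isCriticalPath (fun e a h => (hmem e).1 ⟨a, hold e a h⟩) hcγ.2.2.1 hxy.ne hxγ hyγ ?_
  by_contra hr
  rw [deleteEdges_deleteEdges, Set.union_comm, ← deleteEdges_deleteEdges] at hc'
  have hxw_xy : s(x, y) ≠ s(x, w) := fun h => hwy (Sym2.congr_right.1 h).symm
  have hd := hc'.extend (deleteEdges_adj.2 ⟨hxy, hxw_xy⟩) (hlt _ _ hγ) hxγ hyγ fun β hβ => by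
    by_cases h : β = μ
    · exact hr (h ▸ hβ)
    · obtain ⟨z, hz⟩ := exists_adj_of_reachable hβ.symm hxy.ne'
      exact h (hyμ z β (hold _ _ ((bichrom_adj.1 hz).1.resolve_right (hyγ z))))
  set d := Function.update (Function.update c s(x, w) none) s(x, y) (some γ)
  have hdc : ∀ e, e ≠ s(x, y) → e ≠ s(x, w) → d e = c e := fun e h h' => by
    simp [d, h, h']
  have hdc' : ∀ e a, d e = some a → a ≠ γ → c e = some a := by grind
  obtain ⟨w', hww', hw'x, hw'⟩ := exists_unique_other_neighbor hxw.symm hw2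
  have hwxy : ∀ z, s(w, z) ≠ s(x, y) := fun z => by simp [hxw.ne', hwy]
  obtain ⟨ν, hν⟩ := (hmem s(w, w')).2 (by simpa [hww'] using ⟨fun h => absurd h hxw.ne',
    fun h => absurd h hwy⟩)
  have hdw : ∀ z a, d s(w, z) = some a → a = ν := fun z a h => by
    have h1 : s(w, z) ≠ s(x, w) := by grind
    rw [hdc _ (hwxy z) h1] at h
    rcases hw' z (hadj _ _ _ h).1 with rfl | rfl
    · exact absurd Sym2.eq_swap h1
    · simpa [hν] using h.symm
  obtain ⟨⟨z₂, hz₂, hdeg₂⟩, -, hreach₂⟩ := reachable_and_exists_degree hmin hxw hd hdw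
  have hz₂c : c s(x, z₂) = some ν := by
    rw [hdc] at hz₂
    · exact hz₂
    · intro h
      obtain rfl : z₂ = y := Sym2.congr_right.1 h
      omega
    · intro h
      obtain rfl : z₂ = w := Sym2.congr_right.1 h
      omega
  have hνγ : ν ≠ γ := by
    rintro rfl
    obtain rfl := hprop _ _ _ _ hz₂c hγ
    omega
  obtain ⟨hαν, hdα⟩ := hreach₂ α hα fun z hz => hαx z (hdc' _ _ hz hαγ)
  have hcw : ∀ z, c s(w, z) ≠ some α := fun z hz => by
    rcases hw' z (hadj _ _ _ hz).1 with rfl | rfl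
    · rw [Sym2.eq_swap, hγ] at hz
      exact hαγ (by simpa using hz.symm)
    · exact hαν (by simpa [hν] using hz.symm)
  by_cases hμν : μ = ν
  · subst hμν
    refine hwy (bichrom_end_unique hprop hαx (fun z hz => hαμ (hyμ z α hz)) hcw hxy.ne hxw.ne hcα
      (hdα.mono fun u v h => ?_)).symm
    rw [bichrom_adj] at h ⊢
    exact ⟨h.1.imp (fun h => hdc' _ _ h hμγ) (fun h => hdc' _ _ h hαγ), h.2⟩
  obtain ⟨θ, hθ, hθμ, hθy'⟩ := exists_missing_ne hyy'.symm (by rwa [Sym2.eq_swap])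
    fun z a h => (hadj y' z a h).1
  have hc₁ := (hc.erase s(y, y')).extend (x := y) (y := y') (by simp [hyy', hxy.ne', hy'x]) hθ
    (fun z hz => by grind) (fun z hz => by grind) fun β hβ => by
      obtain ⟨z, hz⟩ := exists_adj_of_reachable hβ hyy'.ne
      rw [bichrom_adj] at hz
      grind
  set c₁ := Function.update (Function.update c s(y, y') none) s(y, y') (some θ)
  have hc₁yy' : c₁ s(y, y') = some θ := by simp [c₁]
  have hc₁c : ∀ e, e ≠ s(y, y') → c₁ e = c e := fun e h => by simp [c₁, h]
  have hxyy' : ∀ z, s(x, z) ≠ s(y, y') := fun z => by simp [hxy.ne, hy'x.symm]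
  have hc₁y : ∀ z a, c₁ s(y, z) = some a → a = θ := fun z a h => by
    by_cases hz : s(y, z) = s(y, y')
    · rw [hz, hc₁yy'] at h
      simpa using h.symm
    · rw [hc₁c _ hz] at h
      exact absurd (by rw [hyc z a h]) hz
  obtain ⟨⟨z₃, hz₃, hdeg₃⟩, -, hreach₃⟩ := reachable_and_exists_degree hmin hxy hc₁ hc₁y
  rw [hc₁c _ (hxyy' _)] at hz₃
  have hθν : θ = ν := by
    by_contra hθν
    have hne : ∀ u v a b, c s(x, u) = some a → c s(x, v) = some b → a ≠ b → u ≠ v := by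
      rintro u v a b hu hv hab rfl
      exact hab (by simpa [hu] using hv)
    have hcard : ({z₁, z₂, z₃} : Finset V).card = 3 := Finset.card_eq_three.2
      ⟨z₁, z₂, z₃, hne _ _ _ _ hz₁ hz₂c hμν, hne _ _ _ _ hz₁ hz₃ (Ne.symm hθμ),
        hne _ _ _ _ hz₂c hz₃ (Ne.symm hθν), rfl⟩
    have hsub : ({z₁, z₂, z₃} : Finset V) ⊆
        (G.neighborFinset x).filter fun z => 3 ≤ G.degree z := by
      intro t ht
      simp only [Finset.mem_insert, Finset.mem_singleton] at ht
      rw [Finset.mem_filter, mem_neighborFinset]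
      rcases ht with rfl | rfl | rfl
      exacts [⟨(hadj _ _ _ hz₁).1, hdeg₁⟩, ⟨(hadj _ _ _ hz₂c).1, hdeg₂⟩,
        ⟨(hadj _ _ _ hz₃).1, hdeg₃⟩]
    have := Finset.card_le_card hsub
    omega
  subst hθν
  have hc₁α : ∀ v, (∀ z, c s(v, z) ≠ some α) → ∀ z, c₁ s(v, z) ≠ some α := fun v hv z hz => by
    by_cases h : s(v, z) = s(y, y')
    · rw [h, hc₁yy'] at hz
      exact hαν (by simpa using hz.symm)
    · exact hv z (by rwa [hc₁c _ h] at hz)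
  have hc₁αx := hc₁α x hαx
  refine hwy (bichrom_end_unique (isAcyclicEdgeColoring_iff.1 hc₁).2.2.1 hc₁αx
    (hc₁α y fun z hz => hαμ (hyμ z α hz)) (hc₁α w hcw) hxy.ne hxw.ne (hreach₃ α hα hc₁αx).2
    (hdα.mono fun u v h => ?_)).symm
  have hkeep : ∀ e a, d e = some a → a ≠ γ → a ≠ μ → c₁ e = some a := fun e a h haγ haμ => by
    have h' := hdc' e a h haγ
    rw [hc₁c]
    · exact h'
    · rintro rfl
      exact haμ (by simpa [hμ] using h'.symm)
  rw [bichrom_adj] at h ⊢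
  exact ⟨h.1.imp (fun h => hkeep _ _ h hνγ (Ne.symm hμν)) (fun h => hkeep _ _ h hαγ hαμ), h.2⟩

end AEC
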